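/- arXiv:2304.14681 — 5 statements merged into one kernel-verified Lean document; each statement's English description precedes it below -/
import Mathlib

section
/- Let (π_α : X_α → Y_α)_{α∈I} be a family of surjections from quasi-topological spaces X_α onto sets Y_α, and let π : ∏X_α → ∏Y_α be the induced surjection of products. Equip each Y_α with the quotient quasi-topology from π_α. Then the product quasi-topology on ∏Y_α coincides with the quotient quasi-topology on ∏Y_α induced by π from the product quasi-topology on ∏X_α. -/
/-!
Statement 1 (Spanier): Given a family of surjections `π_i : X_i → Y_i` from quasi-topological
spaces onto sets, the product quasi-topology on `∏ Y_i` (each `Y_i` carrying the quotient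
quasi-topology) coincides with the quotient quasi-topology induced by the product map
`π : ∏ X_i → ∏ Y_i` from the product quasi-topology on `∏ X_i`.
-/

universe u v w

/-- A family of "admissible" maps from compact Hausdorff test spaces into `X`. -/
def QFam (X : Type w) := ∀ K : CompHaus.{0}, Set (K → X)

/-- A quasi-topological space structure (Spanier): axioms (Q1)–(Q4). -/
structure QuasiTop (X : Type w) where
  Q : QFam X
  const_mem : ∀ (K : CompHaus.{0}) (x : X), (fun _ : K => x) ∈ Q K
  precomp_mem : ∀ (K₁ K₂ : CompHaus.{0}) (f : K₁ → K₂), Continuous f →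
    ∀ ψ ∈ Q K₂, ψ ∘ f ∈ Q K₁
  surj_mem : ∀ (K₁ K₂ : CompHaus.{0}) (f : K₁ → K₂), Continuous f → Function.Surjective f →
    ∀ ψ : K₂ → X, ψ ∘ f ∈ Q K₁ → ψ ∈ Q K₂
  sum_mem : ∀ (K₁ K₂ : CompHaus.{0}) (ψ : (CompHaus.of ((K₁ : Type) ⊕ (K₂ : Type))) → X),
    ψ ∘ Sum.inl ∈ Q K₁ → ψ ∘ Sum.inr ∈ Q K₂ → ψ ∈ Q (CompHaus.of ((K₁ : Type) ⊕ (K₂ : Type)))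

/-- The quotient quasi-topology induced by a surjection `π : X → Y`. -/
def quotientQ {X : Type w} {Y : Type v} (qX : QFam X) (π : X → Y) : QFam Y :=
  fun K => {φ | ∃ (K' : CompHaus.{0}) (π' : K' → K) (φ' : K' → X),
    Continuous π' ∧ Function.Surjective π' ∧ φ' ∈ qX K' ∧ π ∘ φ' = φ ∘ π'}

/-- The product quasi-topology. -/
def prodQ {ι : Type*} {X : ι → Type*} (q : ∀ i, QFam (X i)) : QFam (∀ i, X i) :=
  fun K => {φ | ∀ i, (fun k => φ k i) ∈ q i K}

/-- The fibre product over `K` of a family of compact Hausdorff spaces over `K`. -/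
def wideFiberProduct {ι : Type} {K : CompHaus.{0}} {L : ι → CompHaus.{0}}
    (p : ∀ i, L i → K) : Set (K × ∀ i, L i) :=
  {z | ∀ i, p i (z.2 i) = z.1}

theorem isClosed_wideFiberProduct {ι : Type} {K : CompHaus.{0}} {L : ι → CompHaus.{0}}
    {p : ∀ i, L i → K} (hp : ∀ i, Continuous (p i)) : IsClosed (wideFiberProduct p) := by
  simp only [wideFiberProduct, Set.ofPred_forall]
  exact isClosed_iInter fun i =>
    isClosed_eq ((hp i).comp ((continuous_apply i).comp continuous_snd)) continuous_fst

/-- A family of continuous surjections onto a compact Hausdorff space has a common refinement. -/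
theorem exists_common_refinement {ι : Type} {K : CompHaus.{0}} {L : ι → CompHaus.{0}}
    {p : ∀ i, L i → K} (hp : ∀ i, Continuous (p i)) (hs : ∀ i, Function.Surjective (p i)) :
    ∃ (M : CompHaus.{0}) (r : M → K) (s : ∀ i, M → L i),
      Continuous r ∧ Function.Surjective r ∧ (∀ i, Continuous (s i)) ∧
        ∀ i m, p i (s i m) = r m := by
  have : CompactSpace (wideFiberProduct p) :=
    isCompact_iff_compactSpace.mp (isClosed_wideFiberProduct hp).isCompact
  refine ⟨CompHaus.of (wideFiberProduct p), fun z => z.1.1, fun i z => z.1.2 i,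
    continuous_fst.comp continuous_subtype_val, fun k => ?_,
    fun i => (continuous_apply i).comp (continuous_snd.comp continuous_subtype_val),
    fun i z => z.2 i⟩
  choose t ht using fun i => hs i k
  exact ⟨⟨(k, t), ht⟩, rfl⟩

theorem stmt_1 {ι : Type} {X Y : ι → Type u}
    (q : ∀ i, QuasiTop (X i)) (π : ∀ i, X i → Y i)
    (hπ : ∀ i, Function.Surjective (π i)) :
    prodQ (fun i => quotientQ (q i).Q (π i)) =
      quotientQ (prodQ fun i => (q i).Q) (fun x i => π i (x i)) := by
  funext K
  ext φ
  constructor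
  · intro h
    choose L p ψ hp hs hψ hc using h
    obtain ⟨M, r, s, hr, hrs, hsc, hps⟩ := exists_common_refinement hp hs
    refine ⟨M, r, fun m i => ψ i (s i m), hr, hrs,
      fun i => (q i).precomp_mem M (L i) (s i) (hsc i) (ψ i) (hψ i), ?_⟩
    funext m i
    have h := congrFun (hc i) (s i m)
    simpa only [Function.comp_apply, hps] using h
  · rintro ⟨M, r, ψ, hr, hrs, hψ, hc⟩ i
    exact ⟨M, r, fun m => ψ m i, hr, hrs, hψ i, funext fun m => congrFun (congrFun hc m) i⟩
end

section
/- Let C be a category with a faithful functor U : C → Top such that Uc is a completely Hausdorff topological space for every object c. Then for all objects c, c′ the quasi-topological space [c,c′] (the hom-set with its hom quasi-topology) is completely Hausdorff: for any two distinct morphisms f ≠ g in C(c,c′) there is a quasi-continuous function [c,c′] → [0,1] taking different values at f and at g. -/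
/-!
Statement 3: If `(C, U)` is a concrete category over `Top` with every `U c` completely
Hausdorff, then each hom quasi-space `[c, c']` is completely Hausdorff: distinct morphisms
are separated by a quasi-continuous function to `[0,1]`.
-/

open CategoryTheory

universe u u' v w

/-- Quasi-continuity of a map relative to given families of admissible maps. -/
def QuasiContinuous {X : Type w} {Y : Type v} (qX : QFam X) (qY : QFam Y) (f : X → Y) : Prop :=
  ∀ (K : CompHaus.{0}) (φ : K → X), φ ∈ qX K → f ∘ φ ∈ qY K

/-- The quasi-topology of a topological space. -/
def topQ (Z : Type w) [TopologicalSpace Z] : QFam Z := fun _K => {φ | Continuous φ}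

/-- The hom quasi-topology on `[c, c'] = C(c, c')` for a concrete category over `Top`:
`φ ∈ Q(K, [c, c'])` iff `(k, y) ↦ U(φ k)(y)` is continuous. -/
def homQ {C : Type u} [Category.{u'} C] (U : C ⥤ TopCat.{v}) (c c' : C) : QFam (c ⟶ c') :=
  fun K => {φ | Continuous fun p : K × U.obj c => U.map (φ p.1) p.2}

theorem stmt_3 {C : Type u} [Category.{u'} C] (U : C ⥤ TopCat.{v}) [U.Faithful]
    -- every `U c` is a completely Hausdorff topological space
    (hch : ∀ c : C, ∀ x y : U.obj c, x ≠ y →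
      ∃ f : U.obj c → unitInterval, Continuous f ∧ f x = 0 ∧ f y = 1)
    (c c' : C) (f g : c ⟶ c') (hfg : f ≠ g) :
    ∃ h : (c ⟶ c') → unitInterval,
      QuasiContinuous (homQ U c c') (topQ unitInterval) h ∧ h f ≠ h g := by
  obtain ⟨y, hy⟩ : ∃ y : U.obj c, U.map f y ≠ U.map g y := by
    by_contra! h
    exact hfg (U.map_injective (TopCat.ext h))
  obtain ⟨s, hs, hs0, hs1⟩ := hch c' _ _ hy
  refine ⟨fun k => s (U.map k y), fun K φ hφ => ?_, ?_⟩
  · have hφ' : Continuous fun p : K × U.obj c => U.map (φ p.1) p.2 := hφ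
    exact hs.comp (hφ'.comp (Continuous.prodMk_left y))
  · simp [hs0, hs1]
end

section
/- Let G be a quasi-topological group acting quasi-continuously on a quasi-topological space X. Then the induced action of G on the cone con(X), given by g·[(x,s)] := [(g·x, s)] for g ∈ G, x ∈ X, s ∈ [0,1], is quasi-continuous, i.e. the action map G × con(X) → con(X) is quasi-continuous for the product quasi-topology on G × con(X) and the quotient quasi-topology on con(X). -/
/-! Statement 6: a quasi-continuous action of a quasi-topological group `G` on a
quasi-topological space `X` induces a quasi-continuous action on the cone `con(X)`,
`g • [(x, s)] = [(g • x, s)]`. -/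

universe u v w

/-- The binary product quasi-topology. -/
def prod2Q {X Y : Type*} (qX : QFam X) (qY : QFam Y) : QFam (X × Y) :=
  fun K => {φ | (fun k => (φ k).1) ∈ qX K ∧ (fun k => (φ k).2) ∈ qY K}

/-- The subspace quasi-topology. -/
def subspaceQ {X : Type*} (q : QFam X) (S : Set X) : QFam S :=
  fun K => {φ | (fun k => (φ k : X)) ∈ q K}

/-- Completely Hausdorff quasi-topological space. -/
def QCompletelyHausdorff {X : Type*} (q : QFam X) : Prop :=
  ∀ x y : X, x ≠ y → ∃ f : X → unitInterval,
    QuasiContinuous q (topQ unitInterval) f ∧ f x = 0 ∧ f y = 1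

/-- A quasi-topological group: multiplication and inversion are quasi-continuous. -/
structure QuasiTopGroup (G : Type w) [Group G] (qG : QuasiTop G) : Prop where
  mul_qc : QuasiContinuous (prod2Q qG.Q qG.Q) qG.Q (fun p => p.1 * p.2)
  inv_qc : QuasiContinuous qG.Q qG.Q (fun g => g⁻¹)

/-- The setoid on `X × [0,1]` collapsing `X × {0}` to a point. -/
def coneSetoid (X : Type w) : Setoid (X × unitInterval) where
  r a b := a = b ∨ (a.2 = 0 ∧ b.2 = 0)
  iseqv := by
    refine ⟨fun a => Or.inl rfl, ?_, ?_⟩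
    · rintro a b (rfl | ⟨h1, h2⟩)
      · exact Or.inl rfl
      · exact Or.inr ⟨h2, h1⟩
    · rintro a b c (rfl | ⟨h1, h2⟩) h
      · exact h
      · rcases h with rfl | ⟨h3, h4⟩
        · exact Or.inr ⟨h1, h2⟩
        · exact Or.inr ⟨h1, h4⟩

/-- The unreduced cone of `X`, as a set: `(X × [0,1])/(X × {0})`. -/
def Cone (X : Type w) := Quotient (coneSetoid X)

/-- The canonical quotient map `X × [0,1] → con(X)`. -/
def conePt {X : Type w} (p : X × unitInterval) : Cone X := Quotient.mk (coneSetoid X) p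

/-- The quotient quasi-topology on the cone, induced from the product quasi-topology
on `X × [0,1]`. -/
def coneQ {X : Type w} (q : QFam X) : QFam (Cone X) :=
  quotientQ (prod2Q q (topQ unitInterval)) conePt

/-- The coordinate map `t : con(X) → [0,1]`, `[(x, s)] ↦ s`. -/
def coneT {X : Type w} : Cone X → unitInterval :=
  Quotient.lift (fun p => p.2) fun _a _b h =>
    Or.elim h (fun h => by rw [h]) (fun h => h.1.trans h.2.symm)

/-- The coordinate map `x : t⁻¹((0,1]) → X`, `[(x, s)] ↦ x`. -/
noncomputable def coneX {X : Type w} (c : {c : Cone X // coneT c ≠ 0}) : X :=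
  (Quotient.out c.1).1

/-- The action of `g` on the cone of a `G`-set: `g • [(x, s)] = [(g • x, s)]`. -/
def coneAct {G : Type w} {X : Type w} [SMul G X] (g : G) : Cone X → Cone X :=
  Quotient.map (fun p => (g • p.1, p.2)) fun _a _b h =>
    Or.elim h (fun h => Or.inl (by rw [h])) (fun h => Or.inr ⟨h.1, h.2⟩)

theorem stmt_6 {G X : Type u} [Group G] [MulAction G X]
    (qG : QuasiTop G) (hG : QuasiTopGroup G qG) (qX : QuasiTop X)
    (hact : QuasiContinuous (prod2Q qG.Q qX.Q) qX.Q fun p => p.1 • p.2) :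
    QuasiContinuous (prod2Q qG.Q (coneQ qX.Q)) (coneQ qX.Q)
      (fun p : G × Cone X => coneAct p.1 p.2) := by
  rintro K φ ⟨hφG, L, p, ψ, hp, hps, ⟨hψX, hψI⟩, hψ⟩
  refine ⟨L, p, fun l => ((φ (p l)).1 • (ψ l).1, (ψ l).2), hp, hps, ⟨?_, hψI⟩, ?_⟩
  · exact hact L (fun l => ((φ (p l)).1, (ψ l).1)) ⟨qG.precomp_mem L K p hp _ hφG, hψX⟩
  · funext l
    have hl : conePt (ψ l) = (φ (p l)).2 := congrFun hψ l
    change conePt _ = coneAct (φ (p l)).1 (φ (p l)).2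
    rw [← hl]
    rfl
end

section
/- For any quasi-topological space X, the coordinate maps of the cone con(X), namely t : con(X) → [0,1] defined by [(x,s)] ↦ s, and x : t⁻¹((0,1]) → X defined by [(x,s)] ↦ x (where t⁻¹((0,1]) ⊆ con(X) carries the subspace quasi-topology), are quasi-continuous. -/
/-! Statement 7: for any quasi-topological space `X`, the coordinate maps
`t : con(X) → [0,1]`, `[(x,s)] ↦ s`, and `x : t⁻¹((0,1]) → X`, `[(x,s)] ↦ x`
(with the subspace quasi-topology on the domain) are quasi-continuous. -/

universe u v w

/-- `coneX` recovers the first coordinate of a point of the cone away from the vertex. -/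
theorem coneX_conePt {X : Type u} (p : X × unitInterval) (h : coneT (conePt p) ≠ 0) :
    coneX ⟨conePt p, h⟩ = p.1 := by
  rcases Quotient.exact (Quotient.out_eq (conePt p)) with h' | ⟨-, h'⟩
  · exact congrArg Prod.fst h'
  · exact absurd h' h

theorem stmt_7 {X : Type u} (qX : QuasiTop X) :
    -- `t` is quasi-continuous
    QuasiContinuous (coneQ qX.Q) (topQ unitInterval) coneT ∧
    -- `coneX` is indeed the map `[(x, s)] ↦ x` on `t⁻¹((0,1])` ...
    (∀ (x : X) (s : unitInterval) (h : coneT (conePt (x, s)) ≠ 0),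
      coneX ⟨conePt (x, s), h⟩ = x) ∧
    -- ... and it is quasi-continuous for the subspace quasi-topology
    QuasiContinuous (subspaceQ (coneQ qX.Q) {c | coneT c ≠ 0}) qX.Q
      (fun c => coneX c) := by
  refine ⟨?_, fun x s h => coneX_conePt (x, s) h, ?_⟩
  · rintro K φ ⟨K', π', φ', hπ', hsurj, ⟨-, hφ'⟩, hcomp⟩
    refine (hπ'.isClosedMap.isQuotientMap hπ' hsurj).continuous_iff.2 ?_
    have heq : (coneT ∘ φ) ∘ π' = fun k => (φ' k).2 := by
      rw [Function.comp_assoc, ← hcomp]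
      rfl
    exact heq ▸ hφ'
  · rintro K φ ⟨K', π', φ', hπ', hsurj, ⟨hφ', -⟩, hcomp⟩
    refine qX.surj_mem K' K π' hπ' hsurj _ ?_
    convert hφ' using 1
    funext k
    have hk : conePt (φ' k) = (φ (π' k)).1 := congrFun hcomp k
    have hne : coneT (conePt (φ' k)) ≠ 0 := hk ▸ (φ (π' k)).2
    have hφk : φ (π' k) = ⟨conePt (φ' k), hne⟩ := Subtype.ext hk.symm
    exact (congrArg coneX hφk).trans (coneX_conePt (φ' k) hne)
end

section
/- If X is a completely Hausdorff quasi-topological space, then its cone con(X) is a completely Hausdorff quasi-topological space. -/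
/-! Statement 8: if `X` is a completely Hausdorff quasi-topological space then so is
its cone `con(X)`. -/

universe u v w

/-- A map out of a quotient into a topological space is quasi-continuous as soon as its
composition with the projection is. -/
theorem QuasiContinuous.of_comp_quotient {X : Type u} {Y : Type v} {Z : Type w}
    [TopologicalSpace Z] {qX : QFam X} {π : X → Y} {f : Y → Z}
    (h : QuasiContinuous qX (topQ Z) (f ∘ π)) :
    QuasiContinuous (quotientQ qX π) (topQ Z) f := by
  rintro K φ ⟨K', π', φ', hπ', hsurj, hφ', heq⟩
  have hquot : Topology.IsQuotientMap π' := hπ'.isClosedMap.isQuotientMap hπ' hsurj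
  have hcont : Continuous ((f ∘ π) ∘ φ') := h K' φ' hφ'
  refine hquot.continuous_iff.mpr ?_
  rwa [Function.comp_assoc, ← heq, ← Function.comp_assoc]

theorem quasiContinuous_coneT {X : Type u} (q : QFam X) :
    QuasiContinuous (coneQ q) (topQ unitInterval) (coneT : Cone X → unitInterval) :=
  QuasiContinuous.of_comp_quotient fun _ _ hφ => hφ.2

/-- The function `[(x, s)] ↦ f x * s` on the cone. -/
def coneMul {X : Type u} (f : X → unitInterval) : Cone X → unitInterval :=
  Quotient.lift (fun p => f p.1 * p.2) fun _a _b h =>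
    Or.elim h (fun h => by rw [h]) (fun h => by simp only [h.1, h.2, mul_zero])

theorem quasiContinuous_coneMul {X : Type u} {q : QFam X} {f : X → unitInterval}
    (hf : QuasiContinuous q (topQ unitInterval) f) :
    QuasiContinuous (coneQ q) (topQ unitInterval) (coneMul f) :=
  QuasiContinuous.of_comp_quotient fun K _ hφ =>
    Continuous.mul (show Continuous _ from hf K _ hφ.1) (show Continuous _ from hφ.2)

theorem unitInterval.exists_continuous_eq_zero_eq_one {a b : unitInterval} (h : a ≠ b) :
    ∃ g : unitInterval → unitInterval, Continuous g ∧ g a = 0 ∧ g b = 1 := by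
  have hab : (b : ℝ) - a ≠ 0 := sub_ne_zero.mpr fun e => h (Subtype.ext e.symm)
  refine ⟨fun u => Set.projIcc 0 1 zero_le_one (((u : ℝ) - a) / (b - a)), ?_, ?_, ?_⟩
  · exact continuous_projIcc.comp (by fun_prop)
  · simp
  · simp [div_self hab]

/-- Two points are separated in the sense of complete Hausdorffness as soon as some
quasi-continuous function to the unit interval takes different values there. -/
theorem QuasiContinuous.exists_eq_zero_eq_one {X : Type u} {q : QFam X} {f : X → unitInterval}
    (hf : QuasiContinuous q (topQ unitInterval) f) {x y : X} (h : f x ≠ f y) :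
    ∃ g : X → unitInterval, QuasiContinuous q (topQ unitInterval) g ∧ g x = 0 ∧ g y = 1 := by
  obtain ⟨g, hg, hx, hy⟩ := unitInterval.exists_continuous_eq_zero_eq_one h
  exact ⟨g ∘ f, fun K φ hφ => hg.comp (show Continuous _ from hf K φ hφ), hx, hy⟩

theorem stmt_8 {X : Type u} (qX : QuasiTop X) (hX : QCompletelyHausdorff qX.Q) :
    QCompletelyHausdorff (coneQ qX.Q) := by
  rintro ⟨x, s⟩ ⟨y, t⟩ hne
  by_cases hst : s = t
  · subst hst
    have hs : s ≠ 0 := fun h => hne (Quotient.sound (Or.inr ⟨h, h⟩))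
    have hxy : x ≠ y := fun h => hne (by rw [h])
    obtain ⟨f, hf, hfx, hfy⟩ := hX x y hxy
    refine (quasiContinuous_coneMul hf).exists_eq_zero_eq_one ?_
    change f x * s ≠ f y * s
    rw [hfx, hfy, zero_mul, one_mul]
    exact hs.symm
  · exact (quasiContinuous_coneT qX.Q).exists_eq_zero_eq_one hst
end
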